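/- arXiv:1211.4811 — 3 statements merged into one kernel-verified Lean document; each statement's English description precedes it below -/
import Mathlib

section
/- For every n ≥ 1 and all measurable deterministic functions v_1,…,v_n : E → [0,∞], one has ∫ ∏_{k=1}^n (∫ v_k(y) ξ(dy)) μ(dξ) = ∑_{k=1}^n ∑_{𝒫 = {P_1,…,P_k} ∈ 𝒯_n^k} ∫_{E^k} ∏_{l=1}^k ∏_{i ∈ P_l} v_i(x_l) · (∫_X ĉ((x_1,…,x_k), ξ) μ(dξ)) λ(dx_1)⋯λ(dx_k). (In the paper, ∫_X ĉ((x_1,…,x_k),ξ) μ(dξ) is the correlation function ρ of μ evaluated at {x_1,…,x_k}.) -/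
open MeasureTheory Finset

/-- The compound Papangelou intensity along a tuple:
`ĉ((x_1,…,x_k), ξ) = ∏_{l=1}^k c(x_l, ξ + δ_{x_1} + ⋯ + δ_{x_{l−1}})`. -/
noncomputable def chat {E : Type*} [MeasurableSpace E] (c : E → Measure E → ENNReal)
    {k : ℕ} (x : Fin k → E) (ξ : Measure E) : ENNReal :=
  ∏ l : Fin k, c (x l) (ξ + ∑ j ∈ Finset.univ.filter (fun j => j < l), Measure.dirac (x j))

/-- A fixed enumeration of the blocks of a partition of `{1,…,n}`. -/
noncomputable def blockOf {n : ℕ} (P : Finpartition (Finset.univ : Finset (Fin n)))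
    (l : Fin P.parts.card) : Finset (Fin n) := (P.parts.equivFin.symm l : { B // B ∈ P.parts })


namespace Papangelou

open scoped ENNReal

variable {E : Type*} [MeasurableSpace E]

/-- Integration against `lam` of the effect of adding one particle, weighted by `g` and by the
Papangelou intensity `c`. -/
noncomputable def addOp (lam : Measure E) (c : E → Measure E → ℝ≥0∞) (g : E → ℝ≥0∞)
    (H : Measure E → ℝ≥0∞) (ξ : Measure E) : ℝ≥0∞ :=
  ∫⁻ x, g x * c x ξ * H (ξ + Measure.dirac x) ∂lam

/-- Composition of the operators `addOp` along a list of weights. -/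
noncomputable def iterOp (lam : Measure E) (c : E → Measure E → ℝ≥0∞) (l : List (E → ℝ≥0∞))
    (H : Measure E → ℝ≥0∞) : Measure E → ℝ≥0∞ :=
  l.foldr (addOp lam c) H

@[simp] lemma iterOp_nil (lam : Measure E) (c : E → Measure E → ℝ≥0∞) (H : Measure E → ℝ≥0∞) :
    iterOp lam c [] H = H := rfl

@[simp] lemma iterOp_cons (lam : Measure E) (c : E → Measure E → ℝ≥0∞) (g : E → ℝ≥0∞)
    (l : List (E → ℝ≥0∞)) (H : Measure E → ℝ≥0∞) :
    iterOp lam c (g :: l) H = addOp lam c g (iterOp lam c l H) := rfl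

lemma measurable_add_dirac :
    Measurable fun p : E × Measure E => p.2 + Measure.dirac p.1 :=
  measurable_snd.add (Measure.measurable_dirac.comp measurable_fst)

lemma measurable_addOp {lam : Measure E} [SFinite lam] {c : E → Measure E → ℝ≥0∞}
    (hc : Measurable (Function.uncurry c)) {g : E → ℝ≥0∞} (hg : Measurable g)
    {H : Measure E → ℝ≥0∞} (hH : Measurable H) : Measurable (addOp lam c g H) := by
  have h : Measurable fun p : E × Measure E =>
      g p.1 * c p.1 p.2 * H (p.2 + Measure.dirac p.1) :=
    ((hg.comp measurable_fst).mul hc).mul (hH.comp measurable_add_dirac)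
  exact h.lintegral_prod_left'

lemma measurable_iterOp {lam : Measure E} [SFinite lam] {c : E → Measure E → ℝ≥0∞}
    (hc : Measurable (Function.uncurry c)) {l : List (E → ℝ≥0∞)} (hl : ∀ g ∈ l, Measurable g)
    {H : Measure E → ℝ≥0∞} (hH : Measurable H) : Measurable (iterOp lam c l H) := by
  induction l with
  | nil => exact hH
  | cons g l ih =>
    exact measurable_addOp hc (hl g (by simp)) (ih fun g hg => hl g (by simp [hg]))

/-- The Georgii–Nguyen–Zessin identity. -/
def GNZ (lam : Measure E) (μ : Measure (Measure E)) (c : E → Measure E → ℝ≥0∞) : Prop :=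
  ∀ w : E → Measure E → ℝ≥0∞, Measurable (Function.uncurry w) →
    ∫⁻ ξ, (∫⁻ x, w x ξ ∂ξ) ∂μ = ∫⁻ ξ, ∫⁻ x, w x (ξ + Measure.dirac x) * c x ξ ∂lam ∂μ

lemma GNZ.lintegral_addOp {lam : Measure E} {μ : Measure (Measure E)}
    {c : E → Measure E → ℝ≥0∞} (h : GNZ lam μ c) {g : E → ℝ≥0∞} (hg : Measurable g)
    {H : Measure E → ℝ≥0∞} (hH : Measurable H) :
    ∫⁻ ξ, addOp lam c g H ξ ∂μ = ∫⁻ ξ, (∫⁻ y, g y ∂ξ) * H ξ ∂μ := by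
  have := h (fun x ξ => g x * H ξ) ((hg.comp measurable_fst).mul (hH.comp measurable_snd))
  simp only [lintegral_mul_const _ hg] at this
  rw [this]
  refine lintegral_congr fun ξ => lintegral_congr fun x => ?_
  ring

lemma addOp_lintegral_mul {lam : Measure E} {c : E → Measure E → ℝ≥0∞}
    (hc : Measurable (Function.uncurry c)) {g u : E → ℝ≥0∞} (hg : Measurable g)
    (hu : Measurable u) {H : Measure E → ℝ≥0∞} (hH : Measurable H) :
    addOp lam c g (fun ξ => (∫⁻ y, u y ∂ξ) * H ξ) =
      fun ξ => (∫⁻ y, u y ∂ξ) * addOp lam c g H ξ + addOp lam c (fun x => g x * u x) H ξ := by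
  funext ξ
  have h : Measurable fun x => g x * c x ξ * H (ξ + Measure.dirac x) :=
    (hg.mul (hc.comp measurable_prodMk_right)).mul
      (hH.comp (measurable_add_dirac.comp measurable_prodMk_right))
  unfold addOp
  rw [← lintegral_const_mul _ h, ← lintegral_add_left (h.const_mul _)]
  refine lintegral_congr fun x => ?_
  simp only [lintegral_add_measure, lintegral_dirac' _ hu]
  ring

lemma addOp_add {lam : Measure E} {c : E → Measure E → ℝ≥0∞}
    (hc : Measurable (Function.uncurry c)) {g : E → ℝ≥0∞} (hg : Measurable g)
    {H K : Measure E → ℝ≥0∞} (hH : Measurable H) :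
    addOp lam c g (fun ξ => H ξ + K ξ) = fun ξ => addOp lam c g H ξ + addOp lam c g K ξ := by
  funext ξ
  have h : Measurable fun x => g x * c x ξ * H (ξ + Measure.dirac x) :=
    (hg.mul (hc.comp measurable_prodMk_right)).mul
      (hH.comp (measurable_add_dirac.comp measurable_prodMk_right))
  unfold addOp
  rw [← lintegral_add_left h]
  exact lintegral_congr fun x => mul_add _ _ _

lemma addOp_sum {lam : Measure E} {c : E → Measure E → ℝ≥0∞}
    (hc : Measurable (Function.uncurry c)) {g : E → ℝ≥0∞} (hg : Measurable g)
    {ι : Type*} (s : Finset ι) {H : ι → Measure E → ℝ≥0∞} (hH : ∀ i, Measurable (H i)) :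
    addOp lam c g (fun ξ => ∑ i ∈ s, H i ξ) = fun ξ => ∑ i ∈ s, addOp lam c g (H i) ξ := by
  classical
  induction s using Finset.induction_on with
  | empty => funext ξ; simp [addOp]
  | insert i s hi ih =>
    simp only [Finset.sum_insert hi]
    rw [addOp_add hc hg (hH i), ih]

lemma iterOp_lintegral_mul {lam : Measure E} [SFinite lam] {c : E → Measure E → ℝ≥0∞}
    (hc : Measurable (Function.uncurry c)) {u : E → ℝ≥0∞} (hu : Measurable u)
    {H : Measure E → ℝ≥0∞} (hH : Measurable H) {k : ℕ} (f : Fin k → E → ℝ≥0∞)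
    (hf : ∀ l, Measurable (f l)) :
    iterOp lam c (List.ofFn f) (fun ξ => (∫⁻ y, u y ∂ξ) * H ξ) =
      fun ξ => (∫⁻ y, u y ∂ξ) * iterOp lam c (List.ofFn f) H ξ +
        ∑ l, iterOp lam c (List.ofFn (Function.update f l fun x => f l x * u x)) H ξ := by
  induction k with
  | zero => simp
  | succ k ih =>
    have hm : ∀ f' : Fin k → E → ℝ≥0∞, (∀ l, Measurable (f' l)) →
        Measurable (iterOp lam c (List.ofFn f') H) := fun f' hf' =>
      measurable_iterOp hc (fun g hg => by
        obtain ⟨l, rfl⟩ := List.mem_ofFn.1 hg; exact hf' l) hH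
    have ht : ∀ l, Measurable (f (Fin.succ l)) := fun l => hf _
    have hupd : ∀ l i, Measurable (Function.update (fun j : Fin k => f j.succ) l
        (fun x => f l.succ x * u x) i) := fun l i => by
      rcases eq_or_ne i l with rfl | h
      · simpa using! (ht _).mul hu
      · simpa [Function.update_of_ne h] using ht i
    rw [List.ofFn_succ, iterOp_cons, ih _ ht, addOp_add hc (hf 0)
      (H := fun ξ => (∫⁻ y, u y ∂ξ) * iterOp lam c (List.ofFn fun l => f (Fin.succ l)) H ξ)
      ((Measure.measurable_lintegral hu).mul (hm _ ht)), addOp_lintegral_mul hc (hf 0) hu (hm _ ht),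
      addOp_sum hc (hf 0) _ fun l => hm _ (hupd l)]
    funext ξ
    rw [Fin.sum_univ_succ, iterOp_cons, List.ofFn_succ, iterOp_cons, add_assoc]
    simp only [Function.update_self, ne_eq, Fin.succ_ne_zero, not_false_eq_true,
      Function.update_of_ne, List.ofFn_succ, iterOp_cons]
    congr 2
    refine Finset.sum_congr rfl fun l _ => ?_
    rw [Function.update_of_ne (Fin.succ_ne_zero l).symm]
    congr 3
    exact (Function.update_comp_eq_of_injective f (Fin.succ_injective _) l _).symm

open Classical in
/-- Particles added in sets equal to or disjoint from `A` shift the number of particles in `A`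
deterministically. -/
lemma iterOp_comp_apply_mul {lam : Measure E} [SFinite lam] {c : E → Measure E → ℝ≥0∞}
    (hc : Measurable (Function.uncurry c)) {A : Set E} (hA : MeasurableSet A)
    (K : ℝ≥0∞ → ℝ≥0∞) {H : Measure E → ℝ≥0∞} (hH : Measurable H) (l : List (Set E))
    (hm : ∀ B ∈ l, MeasurableSet B) (hl : ∀ B ∈ l, B = A ∨ Disjoint A B) :
    iterOp lam c (l.map fun B => B.indicator 1) (fun ξ => K (ξ A) * H ξ) =
      fun ξ => K (ξ A + l.count A) * iterOp lam c (l.map fun B => B.indicator 1) H ξ := by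
  induction l with
  | nil => simp
  | cons B l ih =>
    rw [List.map_cons, iterOp_cons, ih (fun B hB => hm B (by simp [hB]))
      (fun B hB => hl B (by simp [hB]))]
    funext ξ
    have hH' : Measurable (iterOp lam c (l.map fun B => B.indicator 1) H) :=
      measurable_iterOp hc (fun g hg => by
        obtain ⟨B', hB', rfl⟩ := List.mem_map.1 hg
        exact measurable_one.indicator (hm B' (by simp [hB']))) hH
    have h : Measurable fun x => B.indicator 1 x * c x ξ *
        iterOp lam c (l.map fun B => B.indicator 1) H (ξ + Measure.dirac x) :=
      ((measurable_one.indicator (hm B (by simp))).mul (hc.comp measurable_prodMk_right)).mul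
        (hH'.comp (measurable_add_dirac.comp measurable_prodMk_right))
    rw [iterOp_cons]
    unfold addOp
    rw [← lintegral_const_mul _ h]
    refine lintegral_congr fun x => ?_
    by_cases hx : x ∈ B
    · have hcount : (ξ + Measure.dirac x) A + (l.count A : ℝ≥0∞) =
          ξ A + ((B :: l).count A : ℕ) := by
        rw [Measure.add_apply, Measure.dirac_apply' _ hA]
        rcases hl B (by simp) with rfl | hd
        · simp [hx, add_assoc, add_comm (1 : ℝ≥0∞)]
        · have hne : B ≠ A := by
            rintro rfl
            exact Set.disjoint_left.1 hd hx hx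
          simp [Set.disjoint_right.1 hd hx, hne]
      simp only [hcount]
      ring
    · simp [hx]

open Classical in
lemma GNZ.lintegral_iterOp_cons {lam : Measure E} [SFinite lam] {μ : Measure (Measure E)}
    {c : E → Measure E → ℝ≥0∞} (h : GNZ lam μ c) (hc : Measurable (Function.uncurry c))
    {H : Measure E → ℝ≥0∞} (hH : Measurable H) (A : Set E) (l : List (Set E))
    (hm : ∀ B ∈ A :: l, MeasurableSet B) (hl : ∀ B ∈ l, B = A ∨ Disjoint A B) :
    ∫⁻ ξ, iterOp lam c ((A :: l).map fun B => B.indicator 1) H ξ ∂μ =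
      ∫⁻ ξ, iterOp lam c (l.map fun B => B.indicator 1)
        (fun ξ => (ξ A - l.count A) * H ξ) ξ ∂μ := by
  have hA := hm A (by simp)
  have hm' : ∀ B ∈ l, MeasurableSet B := fun B hB => hm B (by simp [hB])
  rw [iterOp_comp_apply_mul hc hA (fun t => t - l.count A) hH l hm' hl, List.map_cons, iterOp_cons,
    h.lintegral_addOp (measurable_one.indicator hA) (measurable_iterOp hc (fun g hg => by
        obtain ⟨B', hB', rfl⟩ := List.mem_map.1 hg
        exact measurable_one.indicator (hm' B' hB')) hH)]
  simp [lintegral_indicator_one hA]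

/-- The order in which particles are added to pairwise equal or disjoint sets is irrelevant on
average. -/
lemma GNZ.lintegral_iterOp_perm {lam : Measure E} [SFinite lam] {μ : Measure (Measure E)}
    {c : E → Measure E → ℝ≥0∞} (h : GNZ lam μ c) (hc : Measurable (Function.uncurry c))
    {l l' : List (Set E)} (hll : l.Perm l') (hm : ∀ B ∈ l, MeasurableSet B)
    (hl : ∀ A ∈ l, ∀ B ∈ l, B = A ∨ Disjoint A B)
    {H : Measure E → ℝ≥0∞} (hH : Measurable H) :
    ∫⁻ ξ, iterOp lam c (l.map fun B => B.indicator 1) H ξ ∂μ =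
      ∫⁻ ξ, iterOp lam c (l'.map fun B => B.indicator 1) H ξ ∂μ := by
  classical
  have hmeas : ∀ (A : Set E) (n : ℕ), MeasurableSet A → ∀ {H : Measure E → ℝ≥0∞}, Measurable H →
      Measurable fun ξ : Measure E => (ξ A - n) * H ξ := fun A n hA H hH =>
    ((Measure.measurable_coe hA).sub_const _).mul hH
  induction hll generalizing H with
  | nil => rfl
  | @cons A l l' hll ih =>
    have hm' : ∀ B ∈ A :: l', MeasurableSet B := fun B hB => hm B ((hll.cons A).mem_iff.2 hB)
    rw [h.lintegral_iterOp_cons hc hH A l hm fun B hB => hl A (by simp) B (by simp [hB]),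
      h.lintegral_iterOp_cons hc hH A l' hm'
        fun B hB => hl A (by simp) B ((hll.cons A).mem_iff.2 (by simp [hB])),
      hll.count_eq]
    exact ih (fun B hB => hm B (by simp [hB]))
      (fun A hA B hB => hl A (by simp [hA]) B (by simp [hB])) (hmeas A _ (hm A (by simp)) hH)
  | swap A B l =>
    rcases hl B (by simp) A (by simp) with rfl | hd
    · rfl
    by_cases hAB : A = B
    · subst hAB; rfl
    have hA := hm A (by simp)
    have hB := hm B (by simp)
    have hl' : ∀ C ∈ l, MeasurableSet C := fun C hC => hm C (by simp [hC])
    have hdisj : ∀ D ∈ B :: A :: l, ∀ C ∈ l, C = D ∨ Disjoint D C := fun D hD C hC =>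
      hl D hD C (by simp [hC])
    rw [h.lintegral_iterOp_cons hc hH B (A :: l) hm fun C hC => hl B (by simp) C (by simp [hC]),
      h.lintegral_iterOp_cons hc (hmeas B _ hB hH) A l (by simpa using ⟨hA, hl'⟩)
        (hdisj A (by simp)),
      h.lintegral_iterOp_cons hc hH A (B :: l) (by simpa using ⟨hA, hB, hl'⟩)
        (by simpa using ⟨Or.inr hd.symm, hdisj A (by simp)⟩),
      h.lintegral_iterOp_cons hc (hmeas A _ hA hH) B l (by simpa using ⟨hB, hl'⟩)
        (hdisj B (by simp))]
    simp only [List.count_cons, beq_iff_eq, hAB, Ne.symm hAB, if_false, add_zero, mul_left_comm]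
  | trans h₁ _ ih₁ ih₂ =>
    rw [ih₁ hm hl hH]
    exact ih₂ (fun B hB => hm B (h₁.mem_iff.2 hB))
      (fun A hA B hB => hl A (h₁.mem_iff.2 hA) B (h₁.mem_iff.2 hB)) hH

lemma iSup_mul_iSup_of_monotone {u v : ℕ → ℝ≥0∞} (hu : Monotone u) (hv : Monotone v) :
    (⨆ n, u n) * ⨆ n, v n = ⨆ n, u n * v n := by
  refine le_antisymm ?_ ENNReal.iSup_mul_le
  rw [ENNReal.iSup_mul]
  refine iSup_le fun i => ?_
  rw [ENNReal.mul_iSup]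
  refine iSup_le fun j => le_iSup_of_le (max i j) ?_
  exact mul_le_mul' (hu (le_max_left _ _)) (hv (le_max_right _ _))

lemma prod_iSup_of_monotone {ι : Type*} (s : Finset ι) {u : ι → ℕ → ℝ≥0∞}
    (hu : ∀ i, Monotone (u i)) : ∏ i ∈ s, ⨆ n, u i n = ⨆ n, ∏ i ∈ s, u i n := by
  classical
  induction s using Finset.induction_on with
  | empty => simp
  | insert i s hi ih =>
    simp only [Finset.prod_insert hi]
    rw [ih, iSup_mul_iSup_of_monotone (hu i)
      fun m n hmn => Finset.prod_le_prod' fun j _ => hu j hmn]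

lemma chat_cons (c : E → Measure E → ℝ≥0∞) {k : ℕ} (y : E) (x : Fin k → E) (ξ : Measure E) :
    chat c (Fin.cons y x : Fin (k + 1) → E) ξ = c y ξ * chat c x (ξ + Measure.dirac y) := by
  simp [chat, Fin.prod_univ_succ, Finset.sum_filter, Fin.sum_univ_succ, add_assoc]

lemma measurable_chat {c : E → Measure E → ℝ≥0∞} (hc : Measurable (Function.uncurry c)) (k : ℕ) :
    Measurable fun p : (Fin k → E) × Measure E => chat c p.1 p.2 := by
  refine Finset.measurable_fun_prod _ fun l _ => ?_
  have h : Measurable fun p : (Fin k → E) × Measure E =>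
      p.2 + ∑ j ∈ univ.filter (fun j => j < l), Measure.dirac (p.1 j) :=
    measurable_snd.add (Finset.measurable_fun_sum _ fun j _ =>
      Measure.measurable_dirac.comp ((measurable_pi_apply j).comp measurable_fst))
  exact hc.comp (((measurable_pi_apply l).comp measurable_fst).prodMk h)

lemma measurable_prod_apply {k : ℕ} {f : Fin k → E → ℝ≥0∞} (hf : ∀ l, Measurable (f l)) :
    Measurable fun x : Fin k → E => ∏ l, f l (x l) :=
  Finset.measurable_fun_prod _ fun l _ => (hf l).comp (measurable_pi_apply l)

lemma iterOp_ofFn_one {lam : Measure E} [SigmaFinite lam] {c : E → Measure E → ℝ≥0∞}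
    (hc : Measurable (Function.uncurry c)) {k : ℕ} {f : Fin k → E → ℝ≥0∞}
    (hf : ∀ l, Measurable (f l)) (ξ : Measure E) :
    iterOp lam c (List.ofFn f) 1 ξ =
      ∫⁻ x : Fin k → E, (∏ l, f l (x l)) * chat c x ξ ∂Measure.pi fun _ => lam := by
  induction k generalizing ξ with
  | zero => simp [chat]
  | succ k ih =>
    have hmp := (measurePreserving_piFinSuccAbove (fun _ : Fin (k + 1) => lam) 0).symm
    have hm : ∀ {j : ℕ} {g : Fin j → E → ℝ≥0∞}, (∀ l, Measurable (g l)) → ∀ η : Measure E,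
        Measurable fun x : Fin j → E => (∏ l, g l (x l)) * chat c x η := fun hg η =>
      (measurable_prod_apply hg).mul ((measurable_chat hc _).comp measurable_prodMk_right)
    have hm' : AEMeasurable (fun z => (∏ l, f l ((MeasurableEquiv.piFinSuccAbove
        (fun _ : Fin (k + 1) => E) 0).symm z l)) * chat c ((MeasurableEquiv.piFinSuccAbove
        (fun _ : Fin (k + 1) => E) 0).symm z) ξ) (lam.prod (Measure.pi fun _ : Fin k => lam)) :=
      ((hm hf ξ).comp hmp.measurable).aemeasurable
    refine Eq.trans ?_ (hmp.lintegral_comp (hm hf ξ))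
    refine Eq.trans ?_ (lintegral_prod _ hm').symm
    rw [List.ofFn_succ, iterOp_cons, addOp]
    refine lintegral_congr fun y => ?_
    rw [ih fun l => hf _, ← lintegral_const_mul _ (hm (fun l => hf _) _)]
    refine lintegral_congr fun x => ?_
    have : (MeasurableEquiv.piFinSuccAbove (fun _ : Fin (k + 1) => E) 0).symm (y, x) =
        (Fin.cons y x : Fin (k + 1) → E) := by
      simp [MeasurableEquiv.piFinSuccAbove, Fin.insertNthEquiv]
    rw [this, chat_cons, Fin.prod_univ_succ]
    simp only [Fin.cons_zero, Fin.cons_succ]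
    ring

/-- The integral of a tensor product against the correlation measure of order `k`. -/
noncomputable def corr (lam : Measure E) (μ : Measure (Measure E)) (c : E → Measure E → ℝ≥0∞)
    {k : ℕ} (f : Fin k → E → ℝ≥0∞) : ℝ≥0∞ :=
  ∫⁻ x : Fin k → E, (∏ l, f l (x l)) * ∫⁻ ξ, chat c x ξ ∂μ ∂Measure.pi fun _ => lam

lemma measurable_lintegral_chat {μ : Measure (Measure E)} [SFinite μ] {c : E → Measure E → ℝ≥0∞}
    (hc : Measurable (Function.uncurry c)) (k : ℕ) :
    Measurable fun x : Fin k → E => ∫⁻ ξ, chat c x ξ ∂μ :=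
  (measurable_chat hc k).lintegral_prod_right'

lemma measurable_prod_apply_mul_lintegral_chat {μ : Measure (Measure E)} [SFinite μ]
    {c : E → Measure E → ℝ≥0∞} (hc : Measurable (Function.uncurry c)) {k : ℕ}
    {f : Fin k → E → ℝ≥0∞} (hf : ∀ l, Measurable (f l)) :
    Measurable fun x : Fin k → E => (∏ l, f l (x l)) * ∫⁻ ξ, chat c x ξ ∂μ :=
  (measurable_prod_apply hf).mul (measurable_lintegral_chat hc k)

lemma corr_eq_lintegral_iterOp {lam : Measure E} [SigmaFinite lam] {μ : Measure (Measure E)}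
    [SFinite μ] {c : E → Measure E → ℝ≥0∞} (hc : Measurable (Function.uncurry c)) {k : ℕ}
    {f : Fin k → E → ℝ≥0∞} (hf : ∀ l, Measurable (f l)) :
    corr lam μ c f = ∫⁻ ξ, iterOp lam c (List.ofFn f) 1 ξ ∂μ := by
  simp only [iterOp_ofFn_one hc hf]
  rw [lintegral_lintegral_swap]
  · refine lintegral_congr fun x => ?_
    have h : Measurable fun ξ => chat c x ξ := (measurable_chat hc k).comp measurable_prodMk_left
    rw [lintegral_const_mul _ h]
  · exact (((measurable_prod_apply hf).comp measurable_snd).mul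
      ((measurable_chat hc k).comp measurable_swap)).aemeasurable

lemma corr_eq_iSup {lam : Measure E} [SigmaFinite lam] {μ : Measure (Measure E)}
    [SFinite μ] {c : E → Measure E → ℝ≥0∞} (hc : Measurable (Function.uncurry c)) {k : ℕ}
    {f : Fin k → E → ℝ≥0∞} (hf : ∀ l, Measurable (f l)) :
    corr lam μ c f = ⨆ n, corr lam μ c fun l => SimpleFunc.eapprox (f l) n := by
  have hmono : ∀ l x, Monotone fun n => SimpleFunc.eapprox (f l) n x := fun l x m n hmn =>
    SimpleFunc.monotone_eapprox (f l) hmn x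
  unfold corr
  rw [← lintegral_iSup
    (fun n => measurable_prod_apply_mul_lintegral_chat hc
      fun l => (SimpleFunc.eapprox (f l) n).measurable)
    (fun m n hmn x => mul_le_mul_left (Finset.prod_le_prod' fun l _ => hmono l _ hmn) _)]
  refine lintegral_congr fun x => ?_
  rw [← ENNReal.iSup_mul, ← prod_iSup_of_monotone _ fun l => hmono l (x l)]
  simp only [SimpleFunc.iSup_eapprox_apply (hf _)]

lemma measurableSet_forall_eq {ι : Type*} [Countable ι] (s : ι → SimpleFunc E ℝ≥0∞)
    (p : ι → ℝ≥0∞) : MeasurableSet {x | ∀ j, s j x = p j} := by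
  simp only [Set.ofPred_forall]
  exact MeasurableSet.iInter fun j => (s j).measurableSet_fiber (p j)

lemma corr_simpleFunc_comp_perm {lam : Measure E} [SigmaFinite lam] {μ : Measure (Measure E)}
    [SFinite μ] {c : E → Measure E → ℝ≥0∞} (hc : Measurable (Function.uncurry c)) {k : ℕ}
    (s : Fin k → SimpleFunc E ℝ≥0∞) (σ : Equiv.Perm (Fin k)) :
    corr lam μ c (fun l => s (σ l)) =
      ∑ q ∈ Fintype.piFinset fun _ : Fin k => Fintype.piFinset fun l => (s l).range,
        (∏ l, q l l) * corr lam μ c fun l =>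
          {x | ∀ j, s j x = q (σ l) j}.indicator 1 := by
  classical
  have hs : ∀ l x, s l x = ∑ p ∈ Fintype.piFinset fun l => (s l).range,
      p l * {x | ∀ j, s j x = p j}.indicator 1 x := fun l x => by
    rw [Finset.sum_eq_single fun j => s j x]
    · simp
    · intro p _ hp
      rw [Set.indicator_of_notMem, mul_zero]
      exact fun h => hp (funext fun j => (h j).symm)
    · intro h
      exact absurd (Fintype.mem_piFinset.2 fun j => (s j).mem_range_self x) h
  have hm : ∀ q : Fin k → Fin k → ℝ≥0∞, Measurable fun x : Fin k → E =>
      (∏ l, {x | ∀ j, s j x = q (σ l) j}.indicator (1 : E → ℝ≥0∞) (x l)) *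
        ∫⁻ ξ, chat c x ξ ∂μ := fun q => measurable_prod_apply_mul_lintegral_chat hc
    fun l => measurable_one.indicator (measurableSet_forall_eq s (q (σ l)))
  unfold corr
  rw [Finset.sum_congr rfl fun q _ => (lintegral_const_mul (∏ l, q l l) (hm q)).symm,
    ← lintegral_finsetSum _ fun q _ => (hm q).const_mul _]
  refine lintegral_congr fun x => ?_
  simp only [← mul_assoc]
  rw [← Finset.sum_mul]
  congr 1
  calc ∏ l, s (σ l) (x l) = ∏ l, s l (x (σ.symm l)) := by
        simp [← Equiv.prod_comp σ fun l => s l (x (σ.symm l))]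
    _ = _ := by
      rw [Finset.prod_congr rfl fun l _ => hs l (x (σ.symm l)), Finset.prod_univ_sum]
      refine Finset.sum_congr rfl fun q _ => ?_
      rw [Finset.prod_mul_distrib]
      congr 1
      rw [← Equiv.prod_comp σ]
      simp

lemma GNZ.corr_comp_perm {lam : Measure E} [SigmaFinite lam] {μ : Measure (Measure E)}
    [SFinite μ] {c : E → Measure E → ℝ≥0∞} (h : GNZ lam μ c) (hc : Measurable (Function.uncurry c))
    {k : ℕ} {f : Fin k → E → ℝ≥0∞} (hf : ∀ l, Measurable (f l)) (σ : Equiv.Perm (Fin k)) :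
    corr lam μ c (fun l => f (σ l)) = corr lam μ c f := by
  rw [corr_eq_iSup hc hf, corr_eq_iSup hc fun l => hf (σ l)]
  refine iSup_congr fun n => ?_
  set s : Fin k → SimpleFunc E ℝ≥0∞ := fun l => SimpleFunc.eapprox (f l) n
  refine (corr_simpleFunc_comp_perm hc s σ).trans
    (Eq.trans ?_ (corr_simpleFunc_comp_perm hc s (Equiv.refl _)).symm)
  refine Finset.sum_congr rfl fun q _ => ?_
  congr 1
  set A : Fin k → Set E := fun l => {x | ∀ j, s j x = q l j} with hA
  have hmap : ∀ τ : Equiv.Perm (Fin k),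
      List.ofFn (fun l => (A (τ l)).indicator (1 : E → ℝ≥0∞)) =
        (List.ofFn (A ∘ τ)).map fun B => B.indicator 1 := fun τ => by
    rw [List.map_ofFn]; rfl
  rw [corr_eq_lintegral_iterOp hc fun l => measurable_one.indicator (measurableSet_forall_eq s _),
    corr_eq_lintegral_iterOp hc fun l => measurable_one.indicator (measurableSet_forall_eq s _)]
  change ∫⁻ ξ, iterOp lam c (List.ofFn fun l => (A (σ l)).indicator 1) 1 ξ ∂μ =
    ∫⁻ ξ, iterOp lam c (List.ofFn fun l => (A (Equiv.refl _ l)).indicator 1) 1 ξ ∂μ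
  rw [hmap, hmap]
  refine h.lintegral_iterOp_perm hc (σ.ofFn_comp_perm A) ?_ ?_ measurable_one
  · intro B hB
    obtain ⟨l, rfl⟩ := List.mem_ofFn.1 hB
    exact measurableSet_forall_eq s _
  · intro B hB C hC
    obtain ⟨l, rfl⟩ := List.mem_ofFn.1 hB
    obtain ⟨m, rfl⟩ := List.mem_ofFn.1 hC
    by_cases hq : q (σ m) = q (σ l)
    · exact Or.inl (by simp [hA, hq])
    · refine Or.inr (Set.disjoint_left.2 fun x hx hx' => hq ?_)
      funext j
      exact (hx' j).symm.trans (hx j)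

lemma GNZ.corr_comp_equiv {lam : Measure E} [SigmaFinite lam] {μ : Measure (Measure E)}
    [SFinite μ] {c : E → Measure E → ℝ≥0∞} (h : GNZ lam μ c) (hc : Measurable (Function.uncurry c))
    {k m : ℕ} {f : Fin k → E → ℝ≥0∞} (hf : ∀ l, Measurable (f l)) (e : Fin m ≃ Fin k) :
    corr lam μ c (fun l => f (e l)) = corr lam μ c f := by
  obtain rfl : m = k := by simpa using Fintype.card_congr e
  exact h.corr_comp_perm hc hf e

/-- The products of the functions `v i` over the blocks of an ordered partition. -/
noncomputable def blockProd {α : Type*} {n : ℕ} (p : OrderedFinpartition n)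
    (v : Fin n → α → ℝ≥0∞) (l : Fin p.length) (x : α) : ℝ≥0∞ :=
  ∏ j, v (p.emb l j) x

lemma measurable_blockProd {n : ℕ} (p : OrderedFinpartition n) {v : Fin n → E → ℝ≥0∞}
    (hv : ∀ i, Measurable (v i)) (l : Fin p.length) : Measurable (blockProd p v l) :=
  Finset.measurable_fun_prod _ fun _ _ => hv _

lemma ofFn_blockProd_extendLeft {α : Type*} {n : ℕ} (p : OrderedFinpartition n)
    (v : Fin (n + 1) → α → ℝ≥0∞) :
    List.ofFn (blockProd p.extendLeft v) =
      v 0 :: List.ofFn (blockProd p fun i => v i.succ) := by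
  refine (List.ofFn_succ (n := p.length) (f := blockProd p.extendLeft v)).trans ?_
  congr 1
  funext x
  exact Fin.prod_univ_one fun _ => v 0 x

lemma blockProd_extendMiddle {α : Type*} {n : ℕ} (p : OrderedFinpartition n) (k : Fin p.length)
    (v : Fin (n + 1) → α → ℝ≥0∞) :
    blockProd (p.extendMiddle k) v =
      Function.update (blockProd p fun i => v i.succ) k
        fun x => blockProd p (fun i => v i.succ) k x * v 0 x := by
  funext l x
  change Fin p.length at l
  rcases eq_or_ne l k with rfl | h
  · have hs : Function.update p.partSize l (p.partSize l + 1) l = p.partSize l + 1 := by simp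
    rw [Function.update_self]
    simp only [blockProd, OrderedFinpartition.extendMiddle, dite_true]
    refine (Fintype.prod_equiv (finCongr hs) _ (fun j => v (Fin.cases (motive := fun _ =>
      Fin (n + 1)) 0 (Fin.succ ∘ p.emb l) j) x) fun _ => rfl).trans ?_
    rw [Fin.prod_univ_succ, mul_comm]
    rfl
  · have hs : Function.update p.partSize k (p.partSize k + 1) l = p.partSize l := by simp [h]
    rw [Function.update_of_ne h]
    simp only [blockProd, OrderedFinpartition.extendMiddle, dif_neg h]
    exact Fintype.prod_equiv (finCongr hs) _ (fun j => v (p.emb l j).succ x) fun _ => rfl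

lemma GNZ.lintegral_mul_prod_lintegral {lam : Measure E} [SFinite lam] {μ : Measure (Measure E)}
    {c : E → Measure E → ℝ≥0∞} (h : GNZ lam μ c) (hc : Measurable (Function.uncurry c)) {n : ℕ}
    {v : Fin n → E → ℝ≥0∞} (hv : ∀ i, Measurable (v i)) {H : Measure E → ℝ≥0∞}
    (hH : Measurable H) :
    ∫⁻ ξ, H ξ * ∏ i, (∫⁻ y, v i y ∂ξ) ∂μ =
      ∑ p : OrderedFinpartition n, ∫⁻ ξ, iterOp lam c (List.ofFn (blockProd p v)) H ξ ∂μ := by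
  induction n generalizing H with
  | zero =>
    rw [Fintype.sum_unique]
    simp only [Finset.univ_eq_empty, Finset.prod_empty, mul_one]
    rfl
  | succ n ih =>
    have hw : ∀ p : OrderedFinpartition n, ∀ l, Measurable (blockProd p (fun i => v i.succ) l) :=
      fun p => measurable_blockProd p fun i => hv i.succ
    have hm : ∀ {k : ℕ} {f : Fin k → E → ℝ≥0∞}, (∀ l, Measurable (f l)) →
        Measurable (iterOp lam c (List.ofFn f) H) := fun hf =>
      measurable_iterOp hc (fun g hg => by obtain ⟨l, rfl⟩ := List.mem_ofFn.1 hg; exact hf l) hH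
    have hvH : Measurable fun ξ : Measure E => (∫⁻ y, v 0 y ∂ξ) * H ξ :=
      (Measure.measurable_lintegral (hv 0)).mul hH
    rw [← Fintype.sum_equiv (OrderedFinpartition.extendEquiv n)
      (fun q => ∫⁻ ξ, iterOp lam c (List.ofFn (blockProd (q.1.extend q.2) v)) H ξ ∂μ) _
      (fun q => rfl), Fintype.sum_sigma]
    calc ∫⁻ ξ, H ξ * ∏ i, (∫⁻ y, v i y ∂ξ) ∂μ
        = ∫⁻ ξ, ((∫⁻ y, v 0 y ∂ξ) * H ξ) * ∏ i : Fin n, (∫⁻ y, v i.succ y ∂ξ) ∂μ :=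
          lintegral_congr fun ξ => by rw [Fin.prod_univ_succ]; ring
      _ = _ := by
        rw [ih (fun i => hv i.succ) hvH]
        refine Finset.sum_congr rfl fun p _ => ?_
        simp only [Fintype.sum_option, OrderedFinpartition.extend_none,
          OrderedFinpartition.extend_some, ofFn_blockProd_extendLeft, iterOp_cons]
        have hmul : Measurable fun ξ : Measure E => (∫⁻ y, v 0 y ∂ξ) *
            iterOp lam c (List.ofFn (blockProd p fun i => v i.succ)) H ξ :=
          (Measure.measurable_lintegral (hv 0)).mul (hm (hw p))
        rw [iterOp_lintegral_mul hc (hv 0) hH _ (hw p), h.lintegral_addOp (hv 0) (hm (hw p)),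
          lintegral_add_left hmul, lintegral_finsetSum]
        · simp only [blockProd_extendMiddle]
          rfl
        · intro l _
          rw [← blockProd_extendMiddle]
          exact hm (measurable_blockProd (p.extendMiddle l) hv)

lemma GNZ.lintegral_prod_lintegral {lam : Measure E} [SigmaFinite lam] {μ : Measure (Measure E)}
    [SFinite μ] {c : E → Measure E → ℝ≥0∞} (h : GNZ lam μ c)
    (hc : Measurable (Function.uncurry c)) {n : ℕ} {v : Fin n → E → ℝ≥0∞}
    (hv : ∀ i, Measurable (v i)) :
    ∫⁻ ξ, ∏ i, (∫⁻ y, v i y ∂ξ) ∂μ =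
      ∑ p : OrderedFinpartition n, corr lam μ c (blockProd p v) := by
  simp only [corr_eq_lintegral_iterOp hc (measurable_blockProd _ hv),
    ← h.lintegral_mul_prod_lintegral hc hv measurable_one, Pi.one_apply, one_mul]

/-- The blocks of an ordered partition, as finite sets. -/
def block {n : ℕ} (p : OrderedFinpartition n) (l : Fin p.length) : Finset (Fin n) :=
  Finset.univ.image (p.emb l)

lemma coe_block {n : ℕ} (p : OrderedFinpartition n) (l : Fin p.length) :
    (block p l : Set (Fin n)) = Set.range (p.emb l) := by
  simp [block]

lemma card_block {n : ℕ} (p : OrderedFinpartition n) (l : Fin p.length) :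
    (block p l).card = p.partSize l := by
  rw [block, Finset.card_image_of_injective _ (p.emb_strictMono l).injective, Finset.card_fin]

lemma blockProd_eq {α : Type*} {n : ℕ} (p : OrderedFinpartition n) (v : Fin n → α → ℝ≥0∞) :
    blockProd p v = fun l x => ∏ i ∈ block p l, v i x := by
  funext l x
  rw [block, Finset.prod_image (p.emb_strictMono l).injective.injOn, blockProd]

lemma max_block {n : ℕ} (p : OrderedFinpartition n) (l : Fin p.length) :
    (block p l).max = p.emb l ⟨p.partSize l - 1, Nat.sub_one_lt_of_lt (p.partSize_pos l)⟩ := by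
  refine le_antisymm (Finset.max_le fun i hi => ?_)
    (Finset.le_max (Finset.mem_image_of_mem _ (Finset.mem_univ _)))
  obtain ⟨j, -, rfl⟩ := Finset.mem_image.1 hi
  exact WithBot.coe_le_coe.2 ((p.emb_strictMono l).monotone (Nat.le_sub_one_of_lt j.2))

lemma strictMono_max_block {n : ℕ} (p : OrderedFinpartition n) :
    StrictMono fun l => (block p l).max := fun l m hlm => by
  simp only [max_block]
  exact WithBot.coe_lt_coe.2 (p.parts_strictMono hlm)

lemma block_injective {n : ℕ} (p : OrderedFinpartition n) : Function.Injective (block p) :=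
  .of_comp (f := Finset.max) (strictMono_max_block p).injective

lemma eq_of_block_eq {n : ℕ} {p q : OrderedFinpartition n} (hlen : p.length = q.length)
    (h : ∀ l, block p l = block q (Fin.cast hlen l)) : p = q := by
  have hsize : ∀ l, p.partSize l = q.partSize (Fin.cast hlen l) := fun l => by
    rw [← card_block, ← card_block, h]
  have hemb : ∀ l, Set.range (p.emb l) = Set.range (q.emb (Fin.cast hlen l)) := fun l => by
    rw [← coe_block, ← coe_block, h]
  clear h
  revert hlen
  rcases p with ⟨k, s, -, e, he, -, -, -⟩
  rcases q with ⟨k', s', -, e', he', -, -, -⟩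
  intro hlen hsize hemb
  obtain rfl : k = k' := hlen
  obtain rfl : s = s' := funext hsize
  obtain rfl : e = e' := funext fun l => (StrictMono.range_inj (he l) (he' l)).1 (hemb l)
  rfl

/-- The unordered partition underlying an ordered partition. -/
def toFinpartition {n : ℕ} (p : OrderedFinpartition n) :
    Finpartition (Finset.univ : Finset (Fin n)) where
  parts := Finset.univ.image (block p)
  supIndep := by
    rw [Finset.supIndep_iff_pairwiseDisjoint]
    intro A hA B hB hAB
    obtain ⟨l, -, rfl⟩ := Finset.mem_image.1 hA
    obtain ⟨m, -, rfl⟩ := Finset.mem_image.1 hB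
    rw [Function.onFun, id, id, ← Finset.disjoint_coe, coe_block, coe_block]
    exact p.disjoint (Set.mem_univ l) (Set.mem_univ m) (fun h => hAB (h ▸ rfl))
  sup_parts := by
    refine Finset.eq_univ_iff_forall.2 fun x => ?_
    obtain ⟨l, hl⟩ := p.cover x
    rw [← coe_block] at hl
    exact Finset.mem_sup.2 ⟨block p l, Finset.mem_image_of_mem _ (Finset.mem_univ l), hl⟩
  bot_notMem h := by
    obtain ⟨l, -, hl⟩ := Finset.mem_image.1 h
    exact (p.partSize_pos l).ne' (by rw [← card_block, hl]; rfl)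

lemma toFinpartition_injective {n : ℕ} :
    Function.Injective (toFinpartition : OrderedFinpartition n → _) := by
  intro p q h
  have hparts : Finset.univ.image (block p) = Finset.univ.image (block q) :=
    congrArg Finpartition.parts h
  have hlen : p.length = q.length := by
    simpa [Finset.card_image_of_injective, block_injective] using congrArg Finset.card hparts
  have hrange : Set.range (block p) = Set.range (block q) := by
    simpa using congrArg (fun s : Finset (Finset (Fin n)) => (s : Set (Finset (Fin n)))) hparts
  have hblock : block p = block q ∘ Fin.cast hlen := by
    have hmax : (fun l => (block p l).max) = fun l => (block q (Fin.cast hlen l)).max := by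
      refine (StrictMono.range_inj (strictMono_max_block p)
        ((strictMono_max_block q).comp (Fin.cast_strictMono hlen))).1 ?_
      have hcast : Set.range (fun l => (block q (Fin.cast hlen l)).max) =
          Set.range fun l => (block q l).max :=
        (finCongr hlen).surjective.range_comp fun l => (block q l).max
      refine Eq.trans ?_ hcast.symm
      simpa only [← Set.range_comp] using! congrArg (Set.image Finset.max) hrange
    funext l
    obtain ⟨m, hm⟩ : block p l ∈ Set.range (block q) := hrange ▸ Set.mem_range_self l
    have : m = Fin.cast hlen l := (strictMono_max_block q).injective
      ((congrArg Finset.max hm).trans (congrFun hmax l))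
    rw [← hm, this, Function.comp]
  exact eq_of_block_eq hlen fun l => congrFun hblock l

lemma toFinpartition_surjective {n : ℕ} :
    Function.Surjective (toFinpartition : OrderedFinpartition n → _) := by
  intro P
  have hmem : ∀ {B}, B ∈ P.parts → ∃ i ∈ B, B.max = i := fun hB =>
    ⟨_, Finset.max'_mem _ (P.nonempty_of_mem_parts hB), (Finset.coe_max' _).symm⟩
  have hinj : Set.InjOn Finset.max (P.parts : Set (Finset (Fin n))) := fun B hB C hC hBC => by
    obtain ⟨i, hi, hBi⟩ := hmem hB
    obtain ⟨j, hj, hCj⟩ := hmem hC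
    obtain rfl : i = j := WithBot.coe_injective (hBi.symm.trans (hBC.trans hCj))
    exact P.eq_of_mem_parts hB hC hi hj
  set T := P.parts.image Finset.max
  choose B hB hBT using fun m => Finset.mem_image.1 (T.orderEmbOfFin_mem rfl m)
  have hmono : StrictMono fun m => (B m).max := by
    simpa only [hBT] using (T.orderEmbOfFin rfl).strictMono
  have hsurj : ∀ D ∈ P.parts, ∃ m, B m = D := fun D hD => by
    obtain ⟨m, hm⟩ : D.max ∈ Set.range (T.orderEmbOfFin rfl) := by
      rw [Finset.range_orderEmbOfFin]
      exact Finset.mem_image_of_mem _ hD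
    exact ⟨m, hinj (hB m) hD ((hBT m).trans hm)⟩
  refine ⟨{
    length := T.card
    partSize := fun m => (B m).card
    partSize_pos := fun m => (P.nonempty_of_mem_parts (hB m)).card_pos
    emb := fun m => (B m).orderEmbOfFin rfl
    emb_strictMono := fun m => ((B m).orderEmbOfFin rfl).strictMono
    parts_strictMono := fun l m hlm => ?_
    disjoint := fun l _ m _ hlm => ?_
    cover := fun x => ?_ }, ?_⟩
  · simp only [Finset.orderEmbOfFin_last rfl (P.nonempty_of_mem_parts (hB _)).card_pos]
    rw [← WithBot.coe_lt_coe, Finset.coe_max', Finset.coe_max']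
    exact hmono hlm
  · rw [Function.onFun, Finset.range_orderEmbOfFin, Finset.range_orderEmbOfFin,
      Finset.disjoint_coe]
    exact P.disjoint (hB l) (hB m) fun h => hlm (hmono.injective (congrArg Finset.max h))
  · obtain ⟨D, hD, hx⟩ := P.exists_mem (Finset.mem_univ x)
    obtain ⟨m, rfl⟩ := hsurj D hD
    exact ⟨m, by simpa using hx⟩
  · refine Finpartition.ext (Finset.ext fun D => ?_)
    have hblock : ∀ m, Finset.univ.image ((B m).orderEmbOfFin rfl) = B m := fun m =>
      Finset.image_orderEmbOfFin_univ _ _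
    simp only [toFinpartition, block, hblock, Finset.mem_image, Finset.mem_univ, true_and]
    exact ⟨fun ⟨m, hm⟩ => hm ▸ hB m, hsurj D⟩

lemma GNZ.corr_blockProd {lam : Measure E} [SigmaFinite lam] {μ : Measure (Measure E)}
    [SFinite μ] {c : E → Measure E → ℝ≥0∞} (h : GNZ lam μ c)
    (hc : Measurable (Function.uncurry c)) {n : ℕ} {v : Fin n → E → ℝ≥0∞}
    (hv : ∀ i, Measurable (v i)) (p : OrderedFinpartition n) :
    corr lam μ c (blockProd p v) =
      corr lam μ c fun l x => ∏ i ∈ blockOf (toFinpartition p) l, v i x := by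
  have hb : Function.Bijective fun l : Fin p.length =>
      (⟨block p l, Finset.mem_image_of_mem _ (Finset.mem_univ l)⟩ : (toFinpartition p).parts) := by
    refine ⟨fun l m hlm => block_injective p (congrArg Subtype.val hlm), fun ⟨D, hD⟩ => ?_⟩
    obtain ⟨l, -, rfl⟩ := Finset.mem_image.1 hD
    exact ⟨l, rfl⟩
  rw [← h.corr_comp_equiv hc (f := fun l x => ∏ i ∈ blockOf (toFinpartition p) l, v i x)
    (fun l => Finset.measurable_fun_prod _ fun i _ => hv i)
    ((Equiv.ofBijective _ hb).trans (toFinpartition p).parts.equivFin), blockProd_eq]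
  simp [blockOf]

end Papangelou

/-- Moment formula for deterministic integrands (Corollary 3.5):
`∫ ∏_k ∫ v_k(y) ξ(dy) μ(dξ)
  = ∑_{k=1}^n ∑_{𝒫 ∈ 𝒯_n^k} ∫_{E^k} ∏_l ∏_{i∈P_l} v_i(x_l) (∫_X ĉ(x,ξ) μ(dξ)) λ^k(dx)`,
where `∫_X ĉ((x_1,…,x_k),ξ) μ(dξ)` is the correlation function `ρ({x_1,…,x_k})`. -/
theorem moment_formula_correlation
    {E : Type*} [MeasurableSpace E] (lam : Measure E) [SigmaFinite lam]
    (μ : Measure (Measure E)) [IsProbabilityMeasure μ]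
    (c : E → Measure E → ENNReal) (hc : Measurable (Function.uncurry c))
    (hGNZ : ∀ w : E → Measure E → ENNReal, Measurable (Function.uncurry w) →
      ∫⁻ ξ, (∫⁻ x, w x ξ ∂ξ) ∂μ
        = ∫⁻ ξ, ∫⁻ x, w x (ξ + Measure.dirac x) * c x ξ ∂lam ∂μ)
    (n : ℕ) (hn : 1 ≤ n)
    (v : Fin n → E → ENNReal) (hv : ∀ i, Measurable (v i)) :
    ∫⁻ ξ, ∏ i : Fin n, (∫⁻ y, v i y ∂ξ) ∂μ =
      ∑ k ∈ Finset.Icc 1 n,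
        ∑ P ∈ Finset.univ.filter
            (fun P : Finpartition (Finset.univ : Finset (Fin n)) => P.parts.card = k),
          ∫⁻ x : Fin P.parts.card → E,
            (∏ l : Fin P.parts.card, ∏ i ∈ blockOf P l, v i (x l)) *
              ∫⁻ ξ, chat c x ξ ∂μ
            ∂(Measure.pi fun _ => lam) := by
  have h : Papangelou.GNZ lam μ c := hGNZ
  have hcard : ∀ P ∈ (Finset.univ : Finset (Finpartition (Finset.univ : Finset (Fin n)))),
      P.parts.card ∈ Finset.Icc 1 n := fun P _ => by
    refine Finset.mem_Icc.2 ⟨Finset.card_pos.2 (P.parts_nonempty ?_), ?_⟩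
    · exact (Finset.univ_nonempty_iff.2 ⟨⟨0, hn⟩⟩).ne_empty
    · simpa using P.card_parts_le_card
  rw [Finset.sum_fiberwise_of_maps_to hcard, h.lintegral_prod_lintegral hc hv]
  exact Fintype.sum_bijective _
    ⟨Papangelou.toFinpartition_injective, Papangelou.toFinpartition_surjective⟩ _ _
    fun p => h.corr_blockProd hc hv p
end

section
/- Let R be a commutative semiring, E a type, s a finite set of elements of E, n ≥ 1, and v_1,…,v_n : E → R. Then ∏_{i=1}^n (∑_{x ∈ s} v_i(x)) = ∑_{𝒫 partition of {1,…,n}} ∑_{g} ∏_{B ∈ 𝒫} ∏_{i ∈ B} v_i(g(B)), where the inner sum ranges over all injective maps g from the set of blocks of 𝒫 into s. -/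
namespace Finpartition

variable {ι E : Type*} [Fintype ι] [DecidableEq ι]

/-- The function on the index set that is constant on each block `B` of `P`, with value `g B`. -/
def blockFun (P : Finpartition (Finset.univ : Finset ι)) (g : ∀ B ∈ P.parts, E) : ι → E :=
  fun i => g (P.part i) (P.part_mem.2 (Finset.mem_univ i))

lemma blockFun_of_mem (P : Finpartition (Finset.univ : Finset ι)) (g : ∀ B ∈ P.parts, E)
    {B : Finset ι} (hB : B ∈ P.parts) {i : ι} (hi : i ∈ B) : P.blockFun g i = g B hB := by
  obtain rfl := P.part_eq_of_mem hB hi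
  rfl

lemma mem_part_iff_blockFun_eq (P : Finpartition (Finset.univ : Finset ι))
    {g : ∀ B ∈ P.parts, E} (hg : ∀ B hB C hC, g B hB = g C hC → B = C) {i j : ι} :
    i ∈ P.part j ↔ P.blockFun g i = P.blockFun g j := by
  rw [P.mem_part_iff_part_eq_part (Finset.mem_univ _) (Finset.mem_univ _)]
  refine ⟨fun h => ?_, fun h => (hg _ _ _ _ h).symm ▸ rfl⟩
  simp only [blockFun, h]

lemma parts_eq_image_part (P : Finpartition (Finset.univ : Finset ι)) :
    P.parts = Finset.univ.image P.part := by
  ext B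
  simp only [Finset.mem_image, Finset.mem_univ, true_and]
  constructor
  · intro hB
    obtain ⟨i, hi⟩ := P.nonempty_of_mem_parts hB
    exact ⟨i, P.part_eq_of_mem hB hi⟩
  · rintro ⟨i, rfl⟩
    exact P.part_mem.2 (Finset.mem_univ i)

lemma eq_of_blockFun_eq {P Q : Finpartition (Finset.univ : Finset ι)}
    {g : ∀ B ∈ P.parts, E} {h : ∀ B ∈ Q.parts, E}
    (hg : ∀ B hB C hC, g B hB = g C hC → B = C) (hh : ∀ B hB C hC, h B hB = h C hC → B = C)
    (hgh : P.blockFun g = Q.blockFun h) : P = Q := by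
  have hpart : P.part = Q.part := by
    ext j i
    rw [P.mem_part_iff_blockFun_eq hg, Q.mem_part_iff_blockFun_eq hh, hgh]
  ext1
  rw [P.parts_eq_image_part, Q.parts_eq_image_part, hpart]

lemma blockFun_injective (P : Finpartition (Finset.univ : Finset ι)) :
    Function.Injective (P.blockFun (E := E)) := by
  intro g h hgh
  funext B hB
  obtain ⟨i, hi⟩ := P.nonempty_of_mem_parts hB
  rw [← P.blockFun_of_mem g hB hi, ← P.blockFun_of_mem h hB hi, hgh]

lemma exists_blockFun_eq (f : ι → E) :
    ∃ (P : Finpartition (Finset.univ : Finset ι)) (g : ∀ B ∈ P.parts, E),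
      (∀ B hB C hC, g B hB = g C hC → B = C) ∧ P.blockFun g = f := by
  classical
  let P := ofSetoid (Setoid.ker f)
  have hP {i j : ι} : j ∈ P.part i ↔ f i = f j :=
    mem_part_ofSetoid_iff_rel
  let c : ∀ B ∈ P.parts, ι := fun B hB => (P.nonempty_of_mem_parts hB).choose
  have hc : ∀ B hB, c B hB ∈ B := fun B hB => (P.nonempty_of_mem_parts hB).choose_spec
  refine ⟨P, fun B hB => f (c B hB), fun B hB C hC h => ?_, ?_⟩
  · rw [← hP, P.part_eq_of_mem hB (hc B hB)] at h
    exact P.eq_of_mem_parts hB hC h (hc C hC)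
  · funext i
    exact (hP.1 (hc _ (P.part_mem.2 (Finset.mem_univ i)))).symm

lemma prod_blockFun {R : Type*} [CommMonoid R] (P : Finpartition (Finset.univ : Finset ι))
    (g : ∀ B ∈ P.parts, E) (v : ι → E → R) :
    ∏ B ∈ P.parts.attach, ∏ i ∈ (B : Finset ι), v i (g B.1 B.2) = ∏ i, v i (P.blockFun g i) := by
  have h : ∏ i, v i (P.blockFun g i) = ∏ B ∈ P.parts, ∏ i ∈ B, v i (P.blockFun g i) := by
    conv_lhs => rw [← P.biUnion_parts]
    exact Finset.prod_biUnion P.disjoint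
  rw [h, ← Finset.prod_attach P.parts]
  exact Finset.prod_congr rfl fun B _ => Finset.prod_congr rfl fun i hi => by
    rw [P.blockFun_of_mem g B.2 hi]

end Finpartition

/-- Expansion of a product of sums over partitions of the index set (as used in the
proof of Proposition 3.6): for a commutative semiring `R`, a finite set `s` of
elements of `E`, `n ≥ 1` and `v_1,…,v_n : E → R`,
`∏_{i=1}^n ∑_{x∈s} v_i(x) = ∑_{𝒫} ∑_{g injective : blocks of 𝒫 → s} ∏_{B∈𝒫} ∏_{i∈B} v_i(g(B))`. -/
theorem prod_sum_expansion_partitions {R : Type*} [CommSemiring R] {E : Type*}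
    [DecidableEq E] (s : Finset E) (n : ℕ) (hn : 1 ≤ n) (v : Fin n → E → R) :
    ∏ i : Fin n, ∑ x ∈ s, v i x =
      ∑ P : Finpartition (Finset.univ : Finset (Fin n)),
        ∑ g ∈ (P.parts.pi fun _ => s).filter
            (fun g => ∀ (B : Finset (Fin n)) (hB : B ∈ P.parts)
              (C : Finset (Fin n)) (hC : C ∈ P.parts), g B hB = g C hC → B = C),
          ∏ B ∈ P.parts.attach, ∏ i ∈ (B : Finset (Fin n)), v i (g B.1 B.2) := by
  rw [Finset.prod_univ_sum, Finset.sum_sigma']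
  symm
  refine Finset.sum_bij (fun x _ => x.1.blockFun x.2) ?_ ?_ ?_ ?_
  · rintro ⟨P, g⟩ hx
    simp only [Finset.mem_sigma, Finset.mem_univ, true_and, Finset.mem_filter,
      Finset.mem_pi] at hx
    exact Fintype.mem_piFinset.2 fun i => hx.1 _ _
  · rintro ⟨P, g⟩ hx ⟨Q, h⟩ hy hgh
    simp only [Finset.mem_sigma, Finset.mem_univ, true_and, Finset.mem_filter] at hx hy
    obtain rfl := Finpartition.eq_of_blockFun_eq hx.2 hy.2 hgh
    obtain rfl := P.blockFun_injective hgh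
    rfl
  · intro f hf
    obtain ⟨P, g, hg, rfl⟩ := Finpartition.exists_blockFun_eq f
    refine ⟨⟨P, g⟩, ?_, rfl⟩
    simp only [Finset.mem_sigma, Finset.mem_univ, true_and, Finset.mem_filter, Finset.mem_pi]
    refine ⟨fun B hB => ?_, hg⟩
    obtain ⟨i, hi⟩ := P.nonempty_of_mem_parts hB
    rw [← P.blockFun_of_mem g hB hi]
    exact Fintype.mem_piFinset.1 hf i
  · rintro ⟨P, g⟩ _
    exact P.prod_blockFun g v
end

section
/- Let μ be a probability measure on the configuration space X and for each k ≥ 1 let ρ_k : E^k → [0,∞] be a measurable symmetric function. Assume that for every n ≥ 1 and all measurable v_1,…,v_n : E → [0,∞] one has ∫ ∏_{k=1}^n (∫ v_k(y) ξ(dy)) μ(dξ) = ∑_{k=1}^n ∑_{𝒫 = {P_1,…,P_k} ∈ 𝒯_n^k} ∫_{E^k} ∏_{l=1}^k ∏_{i ∈ P_l} v_i(x_l) · ρ_k(x_1,…,x_k) λ(dx_1)⋯λ(dx_k). Then for every n ≥ 1 and all pairwise disjoint measurable sets A_1,…,A_n ⊆ E, one has ∫ ∏_{i=1}^n ξ(A_i)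 μ(dξ) = ∫_{A_1 × ⋯ × A_n} ρ_n(x_1,…,x_n) λ(dx_1)⋯λ(dx_n). -/
open MeasureTheory Finset

/-- Multiplying a symmetric function by indicators of `A i`, each read off one coordinate, and
integrating amounts to integrating over the box with sides `A i`. -/
theorem lintegral_prod_indicator_mul_symm {E : Type*} [MeasurableSpace E] (lam : Measure E)
    [SigmaFinite lam] (ρ : (k : ℕ) → (Fin k → E) → ENNReal) {m n : ℕ} (h : m = n)
    (hρ_symm : ∀ (σ : Equiv.Perm (Fin n)) (x : Fin n → E), ρ n (x ∘ σ) = ρ n x)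
    (A : Fin n → Set E) (hA : ∀ i, MeasurableSet (A i)) (e : Fin m ≃ Fin n) :
    ∫⁻ x : Fin m → E, (∏ l, (A (e l)).indicator 1 (x l)) * ρ m x ∂(Measure.pi fun _ => lam) =
      ∫⁻ x in Set.univ.pi A, ρ n x ∂(Measure.pi fun _ => lam) := by
  subst h
  have hmp := measurePreserving_arrowCongr' (fun _ : Fin m => lam) (fun _ : Fin m => lam)
    e.symm (MeasurableEquiv.refl E) fun _ => .id lam
  rw [← hmp.lintegral_comp_emb (MeasurableEquiv.measurableEmbedding _),
    ← lintegral_indicator (MeasurableSet.univ_pi hA)]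
  refine lintegral_congr fun x => ?_
  have hx : (MeasurableEquiv.arrowCongr' e.symm (MeasurableEquiv.refl E)) x = x ∘ e := rfl
  simp only [hx, hρ_symm, Function.comp_apply]
  rw [Equiv.prod_comp e fun i => (A i).indicator (1 : E → ENNReal) (x i)]
  by_cases hmem : x ∈ Set.univ.pi A
  · rw [Set.indicator_of_mem hmem, Finset.prod_eq_one, one_mul]
    exact fun i _ => Set.indicator_of_mem (hmem i trivial) _
  · rw [Set.indicator_of_notMem hmem]
    simp only [Set.mem_pi, Set.mem_univ, true_imp_iff, not_forall] at hmem
    obtain ⟨i, hi⟩ := hmem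
    rw [Finset.prod_eq_zero (Finset.mem_univ i) (Set.indicator_of_notMem hi _), zero_mul]

theorem Finpartition.eq_bot_of_parts_subsingleton {α : Type*} [DecidableEq α] {s : Finset α}
    (P : Finpartition s) (h : ∀ B ∈ P.parts, (B : Set α).Subsingleton) : P = ⊥ := by
  refine le_bot_iff.1 fun B hB => ?_
  obtain ⟨a, ha⟩ := P.nonempty_of_mem_parts hB
  refine ⟨{a}, Finpartition.mem_bot_iff.2 ⟨a, P.le hB ha, rfl⟩, fun b hb => ?_⟩
  exact Finset.mem_singleton.2 (h B hB hb ha)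

/-- The blocks of the discrete partition are the singletons. -/
theorem exists_equiv_blockOf_bot (n : ℕ) :
    ∃ e : Fin (⊥ : Finpartition (Finset.univ : Finset (Fin n))).parts.card ≃ Fin n,
      ∀ l, blockOf ⊥ l = {e l} := by
  have hex : ∀ l, ∃ i : Fin n, blockOf (⊥ : Finpartition (Finset.univ : Finset (Fin n))) l = {i} :=
    fun l => by
      obtain ⟨i, -, hi⟩ := Finpartition.mem_bot_iff.1
        ((⊥ : Finpartition (Finset.univ : Finset (Fin n))).parts.equivFin.symm l).2
      exact ⟨i, hi.symm⟩
  choose f hf using hex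
  have hinj : Function.Injective f := fun l l' hl =>
    (Finset.equivFin _).symm.injective <| Subtype.ext <|
      (hf l).trans ((congrArg _ hl).trans (hf l').symm)
  have hbij := (Fintype.bijective_iff_injective_and_card f).2
    ⟨hinj, by simp⟩
  exact ⟨Equiv.ofBijective f hbij, hf⟩

/-- For pairwise disjoint sets, only the discrete partition contributes to the moment formula. -/
theorem lintegral_prod_blockOf_indicator_eq_zero {E : Type*} [MeasurableSpace E] {n : ℕ}
    {P : Finpartition (Finset.univ : Finset (Fin n))} (ν : Measure (Fin P.parts.card → E))
    (A : Fin n → Set E) (hdisj : Pairwise (Function.onFun Disjoint A)) (hP : P ≠ ⊥)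
    (g : (Fin P.parts.card → E) → ENNReal) :
    ∫⁻ x, (∏ l, ∏ i ∈ blockOf P l, (A i).indicator 1 (x l)) * g x ∂ν = 0 := by
  have hblock : ∃ B ∈ P.parts, ¬ (B : Set (Fin n)).Subsingleton := by
    by_contra! h
    exact hP (P.eq_bot_of_parts_subsingleton h)
  obtain ⟨B, hB, hsub⟩ := hblock
  obtain ⟨i, hi, j, hj, hij⟩ := Set.not_subsingleton_iff.1 hsub
  have hl : blockOf P (P.parts.equivFin ⟨B, hB⟩) = B := by simp [blockOf]
  refine (lintegral_congr fun x => ?_).trans lintegral_zero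
  rw [Finset.prod_eq_zero (Finset.mem_univ (P.parts.equivFin ⟨B, hB⟩)), zero_mul]
  rw [hl]
  by_cases hx : x (P.parts.equivFin ⟨B, hB⟩) ∈ A i
  · exact Finset.prod_eq_zero hj
      (Set.indicator_of_notMem (Set.disjoint_left.1 (hdisj hij) hx) _)
  · exact Finset.prod_eq_zero hi (Set.indicator_of_notMem hx _)

/-- Characterization of correlation functions (one direction of Proposition 3.6):
if the symmetric measurable family `ρ_k` satisfies the moment formula
`∫ ∏_k ∫ v_k dξ μ(dξ) = ∑_{k=1}^n ∑_{𝒫 ∈ 𝒯_n^k} ∫_{E^k} ∏_l ∏_{i∈P_l} v_i(x_l) ρ_k(x) λ^k(dx)`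
for all `n ≥ 1` and measurable `v_1,…,v_n`, then for pairwise disjoint measurable sets
`A_1,…,A_n`, `∫ ∏_i ξ(A_i) μ(dξ) = ∫_{A_1×⋯×A_n} ρ_n λ^n(dx)`. -/
theorem correlation_characterization
    {E : Type*} [MeasurableSpace E] (lam : Measure E) [SigmaFinite lam]
    (μ : Measure (Measure E)) [IsProbabilityMeasure μ]
    (ρ : (k : ℕ) → (Fin k → E) → ENNReal)
    (hρ_meas : ∀ k, 1 ≤ k → Measurable (ρ k))
    (hρ_symm : ∀ k, 1 ≤ k → ∀ (σ : Equiv.Perm (Fin k)) (x : Fin k → E),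
      ρ k (x ∘ σ) = ρ k x)
    (hmom : ∀ (n : ℕ), 1 ≤ n → ∀ v : Fin n → E → ENNReal, (∀ i, Measurable (v i)) →
      ∫⁻ ξ, ∏ i : Fin n, (∫⁻ y, v i y ∂ξ) ∂μ =
        ∑ k ∈ Finset.Icc 1 n,
          ∑ P ∈ Finset.univ.filter
              (fun P : Finpartition (Finset.univ : Finset (Fin n)) => P.parts.card = k),
            ∫⁻ x : Fin P.parts.card → E,
              (∏ l : Fin P.parts.card, ∏ i ∈ blockOf P l, v i (x l)) * ρ P.parts.card x
              ∂(Measure.pi fun _ => lam))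
    (n : ℕ) (hn : 1 ≤ n)
    (A : Fin n → Set E) (hA : ∀ i, MeasurableSet (A i))
    (hdisj : Pairwise (Function.onFun Disjoint A)) :
    ∫⁻ ξ, ∏ i : Fin n, ξ (A i) ∂μ =
      ∫⁻ x in Set.univ.pi A, ρ n x ∂(Measure.pi fun _ => lam) := by
  have hmoment := hmom n hn (fun i => (A i).indicator 1)
    fun i => measurable_one.indicator (hA i)
  simp only [lintegral_indicator_one (hA _)] at hmoment
  have hcard : (⊥ : Finpartition (Finset.univ : Finset (Fin n))).parts.card = n := by
    simp
  rw [hmoment, Finset.sum_eq_single_of_mem n (Finset.mem_Icc.2 ⟨hn, le_rfl⟩),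
    Finset.sum_eq_single_of_mem ⊥ (Finset.mem_filter.2 ⟨Finset.mem_univ _, hcard⟩)]
  · obtain ⟨e, he⟩ := exists_equiv_blockOf_bot n
    simp only [he, Finset.prod_singleton]
    exact lintegral_prod_indicator_mul_symm lam ρ hcard (hρ_symm n hn) A hA e
  · exact fun P _ hP => lintegral_prod_blockOf_indicator_eq_zero _ _ hdisj hP _
  · intro k _ hk
    refine Finset.sum_eq_zero fun P hP => ?_
    refine lintegral_prod_blockOf_indicator_eq_zero _ _ hdisj ?_ _
    rintro rfl
    exact hk ((Finset.mem_filter.1 hP).2.symm.trans hcard)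
end
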